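/- Let F = x² z³ + (x² y + 2 y³) z² + 2 x⁴ z + 2 x² y³ + y⁵, a homogeneous polynomial of degree 5 with coefficients in F_3. The number of points of the projective plane ℙ²(F_3) at which F vanishes is exactly 12. (The unique singular point (0:0:1) of V(F) is a cusp, so the normalization of V(F) is a genus-five trigonal curve over F_3 with exactly 12 F_3-rational points, the maximal possible number for a genus-five trigonal curve over F_3.) -/

import Mathlib

namespace TrigonalCusp

/-- The quintic as a function on coordinate vectors. -/
def quintic (v : Fin 3 → ZMod 3) : ZMod 3 :=
  v 0 ^ 2 * v 2 ^ 3 + (v 0 ^ 2 * v 1 + 2 * v 1 ^ 3) * v 2 ^ 2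
    + 2 * v 0 ^ 4 * v 2 + 2 * v 0 ^ 2 * v 1 ^ 3 + v 1 ^ 5

/-- The first nonzero coordinate is `1`. -/
def Normal (v : Fin 3 → ZMod 3) : Prop :=
  v 0 = 1 ∨ (v 0 = 0 ∧ v 1 = 1) ∨ (v 0 = 0 ∧ v 1 = 0 ∧ v 2 = 1)

instance : DecidablePred Normal := fun v => by unfold Normal; infer_instance

lemma quintic_smul (a : ZMod 3) (v : Fin 3 → ZMod 3) :
    quintic (a • v) = a ^ 5 * quintic v := by
  simp only [quintic, Pi.smul_apply, smul_eq_mul]; ring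

lemma Normal.ne_zero {v : Fin 3 → ZMod 3} (h : Normal v) : v ≠ 0 := by
  rintro rfl
  revert h
  decide

lemma quintic_rep (v : Fin 3 → ZMod 3) (hv : v ≠ 0) :
    quintic (Projectivization.mk (ZMod 3) v hv).rep = 0 ↔ quintic v = 0 := by
  obtain ⟨a, ha⟩ := Projectivization.exists_smul_eq_mk_rep (ZMod 3) v hv
  rw [← ha, Units.smul_def, quintic_smul]
  simp

set_option maxRecDepth 100000 in
lemma normal_unique : ∀ (a : ZMod 3) (v : Fin 3 → ZMod 3),
    Normal v → Normal (a • v) → a = 1 := by decide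

set_option maxRecDepth 100000 in
lemma normal_exists : ∀ v : Fin 3 → ZMod 3, v ≠ 0 →
    ∃ a : ZMod 3, a ≠ 0 ∧ Normal (a • v) := by decide

set_option maxRecDepth 100000 in
lemma card_normal :
    Fintype.card {v : Fin 3 → ZMod 3 // Normal v ∧ quintic v = 0} = 12 := by decide

end TrigonalCusp

open TrigonalCusp in
/-- The plane quintic `F₁₆ = x²z³ + (x²y + 2y³)z² + 2x⁴z + 2x²y³ + y⁵`
(cusp case) has exactly `12` zeros in `ℙ²(F₃)`, so its normalization is a genus-five
trigonal curve over `F₃` with `12` `F₃`-rational points. -/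
theorem trigonal_example_cusp_F3_count :
    Nat.card {P : Projectivization (ZMod 3) (Fin 3 → ZMod 3) //
      P.rep 0 ^ 2 * P.rep 2 ^ 3
      + (P.rep 0 ^ 2 * P.rep 1 + 2 * P.rep 1 ^ 3) * P.rep 2 ^ 2
      + 2 * P.rep 0 ^ 4 * P.rep 2
      + 2 * P.rep 0 ^ 2 * P.rep 1 ^ 3 + P.rep 1 ^ 5 = 0} = 12 := by
  change Nat.card {P : Projectivization (ZMod 3) (Fin 3 → ZMod 3) // quintic P.rep = 0} = 12
  rw [← card_normal, ← Nat.card_eq_fintype_card]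
  symm
  refine Nat.card_eq_of_bijective
    (fun v => ⟨Projectivization.mk (ZMod 3) v.1 v.2.1.ne_zero,
      (quintic_rep v.1 v.2.1.ne_zero).2 v.2.2⟩) ⟨?_, ?_⟩
  · rintro ⟨v, hv, hv0⟩ ⟨w, hw, hw0⟩ h
    have h' := congrArg Subtype.val h
    simp only [Projectivization.mk_eq_mk_iff'] at h'
    obtain ⟨a, rfl⟩ := h'
    have := normal_unique a w hw hv
    subst this
    simp
  · rintro ⟨P, hP⟩
    obtain ⟨a, ha, hn⟩ := normal_exists P.rep P.rep_nonzero
    refine ⟨⟨a • P.rep, hn, by rw [quintic_smul, hP, mul_zero]⟩, ?_⟩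
    apply Subtype.ext
    change Projectivization.mk (ZMod 3) (a • P.rep) _ = P
    conv_rhs => rw [← P.mk_rep]
    rw [Projectivization.mk_eq_mk_iff']
    exact ⟨a, rfl⟩
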